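/- arXiv:1202.1259 — 2 statements merged into one kernel-verified Lean document; each statement's English description precedes it below -/
import Mathlib

section
/- Let (X̂_n) and (Ŷ_n) be the embedded chains (at jump times) of two copies of the TCP window size process generated by Lf(x) = f'(x) + r(x)(∫₀¹ f(hx) H(dh) − f(x)), started from initial laws L(X_0) and L(Y_0) with finite p-th moment for some p ≥ 1, with r increasing. Then for every n ≥ 0, with H ∼ H: W^{(p)}(L(X̂_n), L(Ŷ_n)) ≤ E[H^p]^{n/p} · W^{(p)}(L(X_0), L(Y_0)). In particular, if π̂ is the invariant law of X̂, then W^{(p)}(L(X̂_n), π̂) ≤ E[H^p]^{n/p} W^{(p)}(L(X_0), π̂). -/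
open MeasureTheory ProbabilityTheory Filter Set

noncomputable section

/-- `γ` is a coupling of `μ` and `ν`: its marginals are `μ` and `ν`. -/
def IsCoupling (μ ν : Measure ℝ) (γ : Measure (ℝ × ℝ)) : Prop :=
  γ.map Prod.fst = μ ∧ γ.map Prod.snd = ν

/-- The `L¹`-Wasserstein distance `W(μ,ν) = inf ∬ |x-y| γ(dx,dy)` over couplings `γ`. -/
def W1 (μ ν : Measure ℝ) : ℝ :=
  sInf { c | ∃ γ : Measure (ℝ × ℝ), IsProbabilityMeasure γ ∧ IsCoupling μ ν γ ∧
      c = ∫ p, |p.1 - p.2| ∂γ }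

/-- `μ` is supported in `E`. -/
def SuppIn (E : Set ℝ) (μ : Measure ℝ) : Prop := μ Eᶜ = 0

/-- `μ` has a finite first moment. -/
def FinMom (μ : Measure ℝ) : Prop := Integrable (fun x : ℝ => x) μ

/-- A (time-homogeneous) Markov semigroup on `ℝ`, given by its transition kernels. -/
structure MarkovSemigroup where
  ker : ℝ → Kernel ℝ ℝ
  markov : ∀ t, IsMarkovKernel (ker t)
  ker_zero : ker 0 = Kernel.id
  ker_add : ∀ s t : ℝ, 0 ≤ s → 0 ≤ t → ker (s + t) = (ker s).comp (ker t)

/-- Action of the semigroup on measures: `μ ↦ μ P_t`. -/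
def MarkovSemigroup.actM (M : MarkovSemigroup) (t : ℝ) (μ : Measure ℝ) : Measure ℝ :=
  μ.bind (M.ker t)

/-- Action of the semigroup on functions: `P_t f (x) = E[f(X_t) | X_0 = x]`. -/
def MarkovSemigroup.actF (M : MarkovSemigroup) (t : ℝ) (f : ℝ → ℝ) (x : ℝ) : ℝ :=
  ∫ y, f y ∂(M.ker t x)

/-- Wasserstein contraction at rate `ρ` on `E`:
`W(μP_t, νP_t) ≤ e^{-ρt} W(μ,ν)` for all probability measures and all `t ≥ 0`. -/
def WContract (T : ℝ → Measure ℝ → Measure ℝ) (E : Set ℝ) (ρ : ℝ) : Prop :=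
  ∀ μ ν : Measure ℝ, IsProbabilityMeasure μ → IsProbabilityMeasure ν →
    SuppIn E μ → SuppIn E ν → FinMom μ → FinMom ν →
    ∀ t : ℝ, 0 ≤ t → W1 (T t μ) (T t ν) ≤ Real.exp (-ρ * t) * W1 μ ν

/-- `ρ` is the Wasserstein curvature: the largest constant for which the
contraction inequality holds. -/
def IsWCurvature (T : ℝ → Measure ℝ → Measure ℝ) (E : Set ℝ) (ρ : ℝ) : Prop :=
  WContract T E ρ ∧ ∀ ρ' : ℝ, WContract T E ρ' → ρ' ≤ ρ

/-- The `p`-Wasserstein distance `W^{(p)}(μ,ν) = inf (E|X-Y|^p)^{1/p}` over couplings. -/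
def Wp (p : ℝ) (μ ν : Measure ℝ) : ℝ :=
  sInf { c | ∃ γ : Measure (ℝ × ℝ), IsProbabilityMeasure γ ∧ IsCoupling μ ν γ ∧
      c = (∫ q, |q.1 - q.2| ^ p ∂γ) ^ (1 / p) }

/-- The standard exponential distribution (of unit mean) on `ℝ`. -/
def expM : Measure ℝ :=
  volume.withDensity (fun x => ENNReal.ofReal (if 0 ≤ x then Real.exp (-x) else 0))

/-- The transition kernel of the embedded chain of the TCP process:
`x ↦ law of H · R⁻¹(R(x) + E)`, with `H ∼ 𝓗` and `E` standard exponential,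
independent. -/
def tcpChainKer (H : Measure ℝ) (R Rinv : ℝ → ℝ) (x : ℝ) : Measure ℝ :=
  Measure.map (fun q : ℝ × ℝ => q.1 * Rinv (R x + q.2)) (H.prod expM)

/-- The law of the embedded chain after `n` steps, starting from `μ0`. -/
def tcpChainLaw (H : Measure ℝ) (R Rinv : ℝ → ℝ) (μ0 : Measure ℝ) : ℕ → Measure ℝ
  | 0 => μ0
  | n + 1 => (tcpChainLaw H R Rinv μ0 n).bind (tcpChainKer H R Rinv)

lemma expM_prob : IsProbabilityMeasure expM := by
  have h : expM = expMeasure 1 := by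
    unfold expM
    rw [show expMeasure 1 = volume.withDensity (exponentialPDF 1) from rfl]
    congr 1
    funext x
    rw [exponentialPDF_eq]
    simp
  rw [h]
  exact isProbabilityMeasure_expMeasure one_pos

lemma expM_ae : ∀ᵐ e ∂expM, 0 ≤ e := by
  unfold expM
  rw [ae_withDensity_iff]
  · filter_upwards with x hx
    by_contra h
    simp [h] at hx
  · apply Measurable.ennreal_ofReal
    exact Measurable.ite measurableSet_Ici (by fun_prop) measurable_const

lemma suppIn_ae {E : Set ℝ} {μ : Measure ℝ} (h : SuppIn E μ) : ∀ᵐ x ∂μ, x ∈ E := h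

lemma bind_eq_map (μ : Measure ℝ) [IsProbabilityMeasure μ] (Q : Measure (ℝ × ℝ))
    [IsProbabilityMeasure Q] (k : ℝ → Measure ℝ) (g : ℝ × (ℝ × ℝ) → ℝ) (hg : Measurable g)
    (hk : ∀ᵐ x ∂μ, k x = Q.map (fun q => g (x, q))) :
    μ.bind k = (μ.prod Q).map g := by
  have hm : Measurable (fun x : ℝ => Q.map (fun q => g (x, q))) := by
    have h1 : Measurable (fun x : ℝ => (Q.map (Prod.mk x)).map g) :=
      (Measure.measurable_map g hg).comp Measurable.map_prodMk_left
    convert h1 using 2 with x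
    rw [Measure.map_map hg measurable_prodMk_left]
    rfl
  have h2 : μ.bind k = μ.bind (fun x : ℝ => Q.map (fun q => g (x, q))) := by
    unfold Measure.bind
    rw [Measure.map_congr hk]
  rw [h2]
  ext s hs
  rw [Measure.bind_apply hs hm.aemeasurable, Measure.map_apply hg hs,
    Measure.prod_apply (hg hs)]
  refine lintegral_congr fun x => ?_
  exact Measure.map_apply (hg.comp measurable_prodMk_left) hs

lemma coupling_step (μ ν : Measure ℝ) (γ : Measure (ℝ × ℝ)) [IsProbabilityMeasure γ]
    (hγ : IsCoupling μ ν γ) (Q : Measure (ℝ × ℝ)) [IsProbabilityMeasure Q]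
    (g : ℝ × (ℝ × ℝ) → ℝ) (hg : Measurable g) (p : ℝ) (hp : 1 ≤ p)
    (hcostint : Integrable (fun z : ℝ × ℝ => |z.1 - z.2| ^ p) γ)
    (hQ : Integrable (fun q : ℝ × ℝ => q.1 ^ p) Q)
    (hc : ∀ᵐ q ∂Q, 0 ≤ q.1 ∧ ∀ x y, |g (x, q) - g (y, q)| ≤ q.1 * |x - y|) :
    ∃ γ' : Measure (ℝ × ℝ), IsProbabilityMeasure γ' ∧
      IsCoupling ((μ.prod Q).map g) ((ν.prod Q).map g) γ' ∧
      Integrable (fun z : ℝ × ℝ => |z.1 - z.2| ^ p) γ' ∧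
      ∫ z, |z.1 - z.2| ^ p ∂γ' ≤ (∫ q, q.1 ^ p ∂Q) * ∫ z, |z.1 - z.2| ^ p ∂γ := by
  have hp0 : 0 ≤ p := by linarith
  have hF : Measurable (fun w : (ℝ × ℝ) × (ℝ × ℝ) => (g (w.1.1, w.2), g (w.1.2, w.2))) := by
    fun_prop
  have hcost : Measurable (fun z : ℝ × ℝ => |z.1 - z.2| ^ p) := by fun_prop
  have hbi : Integrable (fun w : (ℝ × ℝ) × (ℝ × ℝ) => |w.1.1 - w.1.2| ^ p * w.2.1 ^ p)
      (γ.prod Q) := hcostint.mul_prod hQ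
  have hcae : ∀ᵐ w ∂(γ.prod Q), 0 ≤ w.2.1 ∧
      ∀ x y, |g (x, w.2) - g (y, w.2)| ≤ w.2.1 * |x - y| :=
    Measure.quasiMeasurePreserving_snd.ae hc
  have hle : ∀ᵐ w ∂(γ.prod Q), |g (w.1.1, w.2) - g (w.1.2, w.2)| ^ p ≤
      |w.1.1 - w.1.2| ^ p * w.2.1 ^ p := by
    filter_upwards [hcae] with w hw
    rw [← Real.mul_rpow (abs_nonneg _) hw.1, mul_comm]
    exact Real.rpow_le_rpow (abs_nonneg _) (hw.2 _ _) hp0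
  have hi : Integrable (fun w : (ℝ × ℝ) × (ℝ × ℝ) => |g (w.1.1, w.2) - g (w.1.2, w.2)| ^ p)
      (γ.prod Q) := by
    refine hbi.mono' (hcost.comp hF).aestronglyMeasurable ?_
    filter_upwards [hle] with w hw
    rw [Real.norm_of_nonneg (by positivity)]
    exact hw
  refine ⟨(γ.prod Q).map (fun w => (g (w.1.1, w.2), g (w.1.2, w.2))),
    Measure.isProbabilityMeasure_map hF.aemeasurable, ⟨?_, ?_⟩, ?_, ?_⟩
  · rw [Measure.map_map measurable_fst hF, ← hγ.1]
    have : (γ.map Prod.fst).prod Q = (γ.prod Q).map (Prod.map Prod.fst id) := by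
      rw [← Measure.map_prod_map γ Q measurable_fst measurable_id, Measure.map_id]
    rw [this, Measure.map_map hg (by fun_prop)]
    rfl
  · rw [Measure.map_map measurable_snd hF, ← hγ.2]
    have : (γ.map Prod.snd).prod Q = (γ.prod Q).map (Prod.map Prod.snd id) := by
      rw [← Measure.map_prod_map γ Q measurable_snd measurable_id, Measure.map_id]
    rw [this, Measure.map_map hg (by fun_prop)]
    rfl
  · rw [integrable_map_measure hcost.aestronglyMeasurable hF.aemeasurable]
    exact hi
  · rw [integral_map hF.aemeasurable hcost.aestronglyMeasurable, mul_comm,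
      ← integral_prod_mul]
    exact integral_mono_ae hi hbi hle

/-- Everything needed on `R`. -/
lemma R_facts (r : ℝ → ℝ) (hrpos : ∀ x : ℝ, 0 ≤ x → 0 ≤ r x)
    (hrinc : MonotoneOn r (Set.Ici 0))
    (R Rinv : ℝ → ℝ)
    (hR : ∀ x : ℝ, R x = ∫ u in (0:ℝ)..x, r u)
    (hRinv : ∀ x ∈ Set.Ici (0:ℝ), Rinv (R x) = x) :
    StrictMonoOn R (Set.Ici 0) ∧
    ∀ x y d, 0 ≤ x → x ≤ y → 0 ≤ d → R (x + d) - R x ≤ R (y + d) - R y := by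
  have hii : ∀ a b, 0 ≤ a → 0 ≤ b → IntervalIntegrable r volume a b := by
    intro a b ha hb
    apply MonotoneOn.intervalIntegrable
    apply hrinc.mono
    intro z hz
    rw [Set.mem_uIcc] at hz
    rcases hz with h | h
    · exact le_trans ha h.1
    · exact le_trans hb h.1
  have hdiff : ∀ a b, 0 ≤ a → 0 ≤ b → R b - R a = ∫ u in a..b, r u := by
    intro a b ha hb
    rw [hR, hR, intervalIntegral.integral_interval_sub_left (hii _ _ le_rfl hb) (hii _ _ le_rfl ha)]
  have hmono : MonotoneOn R (Set.Ici 0) := by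
    intro a ha b hb hab
    have : 0 ≤ R b - R a := by
      rw [hdiff a b ha hb]
      exact intervalIntegral.integral_nonneg hab (fun u hu => hrpos u (le_trans ha hu.1))
    linarith
  have hinj : Set.InjOn R (Set.Ici 0) := by
    intro a ha b hb h
    rw [← hRinv a ha, ← hRinv b hb, h]
  refine ⟨hmono.strictMonoOn_of_injOn hinj, ?_⟩
  intro x y d hx hxy hd
  have hy : 0 ≤ y := hx.trans hxy
  rw [hdiff x (x + d) hx (by linarith), hdiff y (y + d) hy (by linarith)]
  have h1 : ∫ u in x..(x + d), r u = ∫ u in (0:ℝ)..d, r (x + u) := by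
    rw [intervalIntegral.integral_comp_add_left]; simp
  have h2 : ∫ u in y..(y + d), r u = ∫ u in (0:ℝ)..d, r (y + u) := by
    rw [intervalIntegral.integral_comp_add_left]; simp
  rw [h1, h2]
  have hi : ∀ z, 0 ≤ z → IntervalIntegrable (fun u => r (z + u)) volume 0 d := by
    intro z hz
    apply MonotoneOn.intervalIntegrable
    rw [Set.uIcc_of_le hd]
    intro a ha b hb hab
    exact hrinc (show (0:ℝ) ≤ _ by linarith [ha.1]) (show (0:ℝ) ≤ _ by linarith [hb.1])
      (by linarith)
  apply intervalIntegral.integral_mono_on hd (hi x hx) (hi y hy)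
  intro u hu
  exact hrinc (show (0:ℝ) ≤ _ by linarith [hu.1]) (show (0:ℝ) ≤ _ by linarith [hu.1])
      (by linarith)

/-- The flow map is a contraction. -/
lemma flow_contract (R Rinv : ℝ → ℝ) (hmono : StrictMonoOn R (Set.Ici 0))
    (hconv : ∀ x y d, 0 ≤ x → x ≤ y → 0 ≤ d → R (x + d) - R x ≤ R (y + d) - R y)
    (hRmap : Set.MapsTo R (Set.Ici 0) (Set.Ici 0))
    (hRinvmap : Set.MapsTo Rinv (Set.Ici 0) (Set.Ici 0))
    (hRinv' : ∀ y ∈ Set.Ici (0:ℝ), R (Rinv y) = y)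
    (e : ℝ) (he : 0 ≤ e) (x y : ℝ) (hx : 0 ≤ x) (hxy : x ≤ y) :
    |Rinv (R x + e) - Rinv (R y + e)| ≤ |x - y| := by
  have hy : 0 ≤ y := hx.trans hxy
  have hRx : 0 ≤ R x := hRmap hx
  have hRy : 0 ≤ R y := hRmap hy
  have hRxy : R x ≤ R y := hmono.monotoneOn hx hy hxy
  have hu0 : 0 ≤ Rinv (R x + e) := hRinvmap (show (0:ℝ) ≤ _ by linarith)
  have hv0 : 0 ≤ Rinv (R y + e) := hRinvmap (show (0:ℝ) ≤ _ by linarith)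
  have hu : R (Rinv (R x + e)) = R x + e := hRinv' _ (show (0:ℝ) ≤ _ by linarith)
  have hv : R (Rinv (R y + e)) = R y + e := hRinv' _ (show (0:ℝ) ≤ _ by linarith)
  set u := Rinv (R x + e)
  set v := Rinv (R y + e)
  have hxu : x ≤ u := (hmono.le_iff_le hx hu0).1 (by linarith)
  have huv : u ≤ v := (hmono.le_iff_le hu0 hv0).1 (by linarith)
  rw [abs_of_nonpos (by linarith), abs_of_nonpos (by linarith)]
  by_contra hlt
  push Not at hlt
  have h1 : R (u + (y - x)) < R v :=
    hmono (show (0:ℝ) ≤ _ by linarith) hv0 (by linarith)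
  have h2 := hconv x u (y - x) hx hxu (by linarith)
  rw [show x + (y - x) = y by ring] at h2
  linarith

lemma tcp_aux (r : ℝ → ℝ) (hrpos : ∀ x : ℝ, 0 ≤ x → 0 ≤ r x)
    (hrinc : MonotoneOn r (Set.Ici 0))
    (R Rinv : ℝ → ℝ)
    (hR : ∀ x : ℝ, R x = ∫ u in (0:ℝ)..x, r u)
    (hRmap : Set.MapsTo R (Set.Ici 0) (Set.Ici 0))
    (hRinvmap : Set.MapsTo Rinv (Set.Ici 0) (Set.Ici 0))
    (hRinv : ∀ x ∈ Set.Ici (0:ℝ), Rinv (R x) = x)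
    (hRinv' : ∀ y ∈ Set.Ici (0:ℝ), R (Rinv y) = y)
    (H : Measure ℝ) (hHprob : IsProbabilityMeasure H)
    (hHsupp : SuppIn (Set.Icc 0 1) H)
    (p : ℝ) (hp : 1 ≤ p) (μ0 ν0 : Measure ℝ)
    (hμ : IsProbabilityMeasure μ0) (hν : IsProbabilityMeasure ν0)
    (hμs : SuppIn (Set.Ici 0) μ0) (hνs : SuppIn (Set.Ici 0) ν0)
    (hμi : Integrable (fun x : ℝ => |x| ^ p) μ0) (hνi : Integrable (fun x : ℝ => |x| ^ p) ν0)
    (n : ℕ) :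
    Wp p (tcpChainLaw H R Rinv μ0 n) (tcpChainLaw H R Rinv ν0 n) ≤
          (∫ h, h ^ p ∂H) ^ ((n : ℝ) / p) * Wp p μ0 ν0 := by
  have := expM_prob
  have hp0 : 0 < p := by linarith
  obtain ⟨hmono, hconv⟩ := R_facts r hrpos hrinc R Rinv hR hRinv
  have hmonoI : MonotoneOn Rinv (Set.Ici 0) := by
    intro a ha b hb hab
    rw [← hmono.le_iff_le (hRinvmap ha) (hRinvmap hb), hRinv' a ha, hRinv' b hb]
    exact hab
  have hRp : Measurable (fun x => R (max x 0)) := by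
    apply Monotone.measurable
    intro a b hab
    exact hmono.monotoneOn (le_max_right a 0) (le_max_right b 0) (max_le_max_right 0 hab)
  have hIp : Measurable (fun x => Rinv (max x 0)) := by
    apply Monotone.measurable
    intro a b hab
    exact hmonoI (le_max_right a 0) (le_max_right b 0) (max_le_max_right 0 hab)
  set g : ℝ × (ℝ × ℝ) → ℝ := fun w => w.2.1 * Rinv (max (R (max w.1 0) + w.2.2) 0) with hgdef
  have hg : Measurable g := by
    have h1 : Measurable (fun w : ℝ × (ℝ × ℝ) => R (max w.1 0)) := hRp.comp measurable_fst
    have h2 : Measurable (fun w : ℝ × (ℝ × ℝ) => R (max w.1 0) + w.2.2) :=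
      h1.add (by fun_prop)
    have h3 := hIp.comp h2
    exact (by fun_prop : Measurable (fun w : ℝ × (ℝ × ℝ) => w.2.1)).mul h3
  set Q := H.prod expM with hQdef
  have hQ1 : ∀ᵐ q ∂Q, q.1 ∈ Set.Icc (0:ℝ) 1 :=
    Measure.quasiMeasurePreserving_fst.ae (suppIn_ae hHsupp)
  have hQ2 : ∀ᵐ q ∂Q, 0 ≤ q.2 := Measure.quasiMeasurePreserving_snd.ae expM_ae
  have hQi : Integrable (fun q : ℝ × ℝ => q.1 ^ p) Q := by
    refine Integrable.of_bound (C := 1) (by fun_prop : Measurable _).aestronglyMeasurable ?_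
    filter_upwards [hQ1] with q hq
    rw [Real.norm_of_nonneg (Real.rpow_nonneg hq.1 p)]
    exact Real.rpow_le_one hq.1 hq.2 hp0.le
  have hQe : ∫ q, q.1 ^ p ∂Q = ∫ h, h ^ p ∂H := by
    rw [hQdef, integral_fun_fst (fun h : ℝ => h ^ p)]
    simp
  have hk : ∀ x, 0 ≤ x → tcpChainKer H R Rinv x = Q.map (fun q => g (x, q)) := by
    intro x hx
    unfold tcpChainKer
    apply Measure.map_congr
    filter_upwards [hQ2] with q hq
    have : 0 ≤ R x := hRmap hx
    simp only [hgdef, max_eq_left hx]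
    rw [max_eq_left (by linarith)]
  have hc : ∀ᵐ q ∂Q, 0 ≤ q.1 ∧ ∀ x y, |g (x, q) - g (y, q)| ≤ q.1 * |x - y| := by
    filter_upwards [hQ1, hQ2] with q hq1 hq2
    refine ⟨hq1.1, fun x y => ?_⟩
    simp only [hgdef]
    have hx : 0 ≤ R (max x 0) := hRmap (le_max_right x 0)
    have hy : 0 ≤ R (max y 0) := hRmap (le_max_right y 0)
    rw [max_eq_left (by linarith : 0 ≤ R (max x 0) + q.2),
      max_eq_left (by linarith : 0 ≤ R (max y 0) + q.2), ← mul_sub, abs_mul, abs_of_nonneg hq1.1]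
    apply mul_le_mul_of_nonneg_left _ hq1.1
    refine le_trans ?_ (abs_max_sub_max_le_abs x y 0)
    rcases le_total (max x 0) (max y 0) with h | h
    · exact flow_contract R Rinv hmono hconv hRmap hRinvmap hRinv' q.2 hq2 _ _
        (le_max_right x 0) h
    · rw [abs_sub_comm, abs_sub_comm (max x 0)]
      exact flow_contract R Rinv hmono hconv hRmap hRinvmap hRinv' q.2 hq2 _ _
        (le_max_right y 0) h
  have hlaw : ∀ μ : Measure ℝ, IsProbabilityMeasure μ → SuppIn (Set.Ici 0) μ →
      μ.bind (tcpChainKer H R Rinv) = (μ.prod Q).map g := by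
    intro μ hμ hs
    apply bind_eq_map μ Q _ g hg
    filter_upwards [suppIn_ae hs] with x hx
    exact hk x hx
  have hsupp : ∀ μ : Measure ℝ, IsProbabilityMeasure μ → SuppIn (Set.Ici 0) μ →
      ∀ m, IsProbabilityMeasure (tcpChainLaw H R Rinv μ m) ∧
        SuppIn (Set.Ici 0) (tcpChainLaw H R Rinv μ m) := by
    intro μ hμ hs m
    induction m with
    | zero => exact ⟨hμ, hs⟩
    | succ m ih =>
      obtain ⟨h1, h2⟩ := ih
      simp only [tcpChainLaw]
      rw [hlaw _ h1 h2]
      refine ⟨Measure.isProbabilityMeasure_map hg.aemeasurable, ?_⟩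
      change ∀ᵐ x ∂_, (0:ℝ) ≤ x
      rw [ae_map_iff hg.aemeasurable measurableSet_Ici]
      have : ∀ᵐ w ∂((tcpChainLaw H R Rinv μ m).prod Q), w.2.1 ∈ Set.Icc (0:ℝ) 1 :=
        Measure.quasiMeasurePreserving_snd.ae hQ1
      filter_upwards [this] with w hw
      exact mul_nonneg hw.1 (hRinvmap (Set.mem_Ici.2 (le_max_right _ 0)))
  set c := ∫ h, h ^ p ∂H with hcdef
  have hc0 : 0 ≤ c := by
    apply integral_nonneg_of_ae
    filter_upwards [suppIn_ae hHsupp] with h hh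
    exact Real.rpow_nonneg hh.1 p
  -- main bound for each coupling
  have key : ∀ γ : Measure (ℝ × ℝ), IsProbabilityMeasure γ → IsCoupling μ0 ν0 γ →
      Integrable (fun z : ℝ × ℝ => |z.1 - z.2| ^ p) γ → ∀ m,
      ∃ γ' : Measure (ℝ × ℝ), IsProbabilityMeasure γ' ∧
      IsCoupling (tcpChainLaw H R Rinv μ0 m) (tcpChainLaw H R Rinv ν0 m) γ' ∧
      Integrable (fun z : ℝ × ℝ => |z.1 - z.2| ^ p) γ' ∧
      ∫ z, |z.1 - z.2| ^ p ∂γ' ≤ c ^ m * ∫ z, |z.1 - z.2| ^ p ∂γ := by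
    intro γ h1 h2 h3 m
    induction m with
    | zero => exact ⟨γ, h1, h2, h3, by simp⟩
    | succ m ih =>
      obtain ⟨γ', k1, k2, k3, k4⟩ := ih
      obtain ⟨γ'', l1, l2, l3, l4⟩ := coupling_step _ _ γ' k2 Q g hg p hp k3 hQi hc
      refine ⟨γ'', l1, ?_, l3, ?_⟩
      · simp only [tcpChainLaw]
        rw [hlaw _ (hsupp μ0 hμ hμs m).1 (hsupp μ0 hμ hμs m).2,
          hlaw _ (hsupp ν0 hν hνs m).1 (hsupp ν0 hν hνs m).2]
        exact l2
      · rw [hQe] at l4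
        refine l4.trans ?_
        rw [pow_succ', mul_assoc]
        exact mul_le_mul_of_nonneg_left k4 hc0
  have hcint : ∀ γ : Measure (ℝ × ℝ), IsProbabilityMeasure γ → IsCoupling μ0 ν0 γ →
      Integrable (fun z : ℝ × ℝ => |z.1 - z.2| ^ p) γ := by
    intro γ h1 h2
    have i1 : Integrable (fun z : ℝ × ℝ => |z.1| ^ p) γ := by
      have := h2.1 ▸ hμi
      exact this.comp_measurable measurable_fst
    have i2 : Integrable (fun z : ℝ × ℝ => |z.2| ^ p) γ := by
      have := h2.2 ▸ hνi
      exact this.comp_measurable measurable_snd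
    refine ((i1.add i2).const_mul (2 ^ p)).mono'
      (by fun_prop : Measurable _).aestronglyMeasurable ?_
    filter_upwards with z
    rw [Real.norm_of_nonneg (by positivity)]
    simp only [Pi.add_apply]
    have ha : |z.1 - z.2| ≤ 2 * max |z.1| |z.2| := by
      have := abs_sub z.1 z.2
      have h3 := le_max_left |z.1| |z.2|
      have h4 := le_max_right |z.1| |z.2|
      linarith
    calc |z.1 - z.2| ^ p ≤ (2 * max |z.1| |z.2|) ^ p :=
          Real.rpow_le_rpow (abs_nonneg _) ha hp0.le
      _ = 2 ^ p * (max |z.1| |z.2|) ^ p := Real.mul_rpow (by norm_num) (by positivity)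
      _ ≤ 2 ^ p * (|z.1| ^ p + |z.2| ^ p) := by
          apply mul_le_mul_of_nonneg_left _ (by positivity)
          have h3 : 0 ≤ |z.1| ^ p := by positivity
          have h4 : 0 ≤ |z.2| ^ p := by positivity
          rcases max_choice |z.1| |z.2| with h | h <;> rw [h] <;> linarith
  have hbound : ∀ γ : Measure (ℝ × ℝ), IsProbabilityMeasure γ → IsCoupling μ0 ν0 γ →
      Wp p (tcpChainLaw H R Rinv μ0 n) (tcpChainLaw H R Rinv ν0 n) ≤
        c ^ ((n : ℝ) / p) * (∫ q, |q.1 - q.2| ^ p ∂γ) ^ (1 / p) := by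
    intro γ h1 h2
    obtain ⟨γ', k1, k2, k3, k4⟩ := key γ h1 h2 (hcint γ h1 h2) n
    have hI : ∀ γ : Measure (ℝ × ℝ), 0 ≤ ∫ z : ℝ × ℝ, |z.1 - z.2| ^ p ∂γ := fun γ =>
      integral_nonneg fun z => by positivity
    have hle : Wp p (tcpChainLaw H R Rinv μ0 n) (tcpChainLaw H R Rinv ν0 n) ≤
        (∫ q, |q.1 - q.2| ^ p ∂γ') ^ (1 / p) := by
      apply csInf_le
      · refine ⟨0, ?_⟩
        rintro a ⟨δ, _, _, rfl⟩
        exact Real.rpow_nonneg (hI δ) _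
      · exact ⟨γ', k1, k2, rfl⟩
    refine hle.trans ((Real.rpow_le_rpow (hI γ') k4 (by positivity)).trans (le_of_eq ?_))
    rw [Real.mul_rpow (by positivity) (hI γ), ← Real.rpow_natCast, ← Real.rpow_mul hc0]
    congr 2
    ring
  have hne : { a | ∃ γ : Measure (ℝ × ℝ), IsProbabilityMeasure γ ∧ IsCoupling μ0 ν0 γ ∧
      a = (∫ q, |q.1 - q.2| ^ p ∂γ) ^ (1 / p) }.Nonempty := by
    refine ⟨_, μ0.prod ν0, inferInstance, ⟨?_, ?_⟩, rfl⟩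
    · simp [Measure.map_fst_prod]
    · simp [Measure.map_snd_prod]
  have hC : 0 ≤ c ^ ((n : ℝ) / p) := Real.rpow_nonneg hc0 _
  rcases hC.eq_or_lt with h0 | h0
  · obtain ⟨_, γ, h1, h2, _⟩ := hne
    have := hbound γ h1 h2
    rw [← h0] at this ⊢
    simpa using this
  · rw [mul_comm, ← div_le_iff₀ h0]
    apply le_csInf hne
    rintro a ⟨γ, h1, h2, rfl⟩
    rw [div_le_iff₀ h0, mul_comm]
    exact hbound γ h1 h2

/-- Wasserstein exponential ergodicity for the embedded TCP chain.
Let `X̂` and `Ŷ` be the embedded chains (at the jump times) of the TCP process with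
increasing jump rate `r` (antiderivative `R`, inverse `R⁻¹`), started from laws with
finite `p`-th moment, `p ≥ 1`. Then for every `n`,
`W^{(p)}(L(X̂_n), L(Ŷ_n)) ≤ E[H^p]^{n/p} W^{(p)}(L(X_0), L(Y_0))`; in particular, if
`π̂` is the invariant law of the chain, `W^{(p)}(L(X̂_n), π̂) ≤ E[H^p]^{n/p}
W^{(p)}(L(X_0), π̂)`. -/
theorem stmt14_tcp_embedded_chain_wasserstein
    (r : ℝ → ℝ) (hrpos : ∀ x : ℝ, 0 ≤ x → 0 ≤ r x)
    (hrinc : MonotoneOn r (Set.Ici 0))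
    (R Rinv : ℝ → ℝ)
    (hR : ∀ x : ℝ, R x = ∫ u in (0:ℝ)..x, r u)
    (hRmap : Set.MapsTo R (Set.Ici 0) (Set.Ici 0))
    (hRinvmap : Set.MapsTo Rinv (Set.Ici 0) (Set.Ici 0))
    (hRinv : ∀ x ∈ Set.Ici (0:ℝ), Rinv (R x) = x)
    (hRinv' : ∀ y ∈ Set.Ici (0:ℝ), R (Rinv y) = y)
    (H : Measure ℝ) (hHprob : IsProbabilityMeasure H)
    (hHsupp : SuppIn (Set.Icc 0 1) H)
    (p : ℝ) (hp : 1 ≤ p) :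
    (∀ μ0 ν0 : Measure ℝ,
      IsProbabilityMeasure μ0 → IsProbabilityMeasure ν0 →
      SuppIn (Set.Ici 0) μ0 → SuppIn (Set.Ici 0) ν0 →
      Integrable (fun x : ℝ => |x| ^ p) μ0 → Integrable (fun x : ℝ => |x| ^ p) ν0 →
      ∀ n : ℕ,
        Wp p (tcpChainLaw H R Rinv μ0 n) (tcpChainLaw H R Rinv ν0 n) ≤
          (∫ h, h ^ p ∂H) ^ ((n : ℝ) / p) * Wp p μ0 ν0) ∧
    (∀ μ0 πhat : Measure ℝ,
      IsProbabilityMeasure μ0 → IsProbabilityMeasure πhat →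
      SuppIn (Set.Ici 0) μ0 → SuppIn (Set.Ici 0) πhat →
      Integrable (fun x : ℝ => |x| ^ p) μ0 → Integrable (fun x : ℝ => |x| ^ p) πhat →
      -- `π̂` is invariant for the embedded chain
      πhat.bind (tcpChainKer H R Rinv) = πhat →
      ∀ n : ℕ,
        Wp p (tcpChainLaw H R Rinv μ0 n) πhat ≤
          (∫ h, h ^ p ∂H) ^ ((n : ℝ) / p) * Wp p μ0 πhat) := by
  refine ⟨fun μ0 ν0 h1 h2 h3 h4 h5 h6 n => tcp_aux r hrpos hrinc R Rinv hR hRmap hRinvmap hRinv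
    hRinv' H hHprob hHsupp p hp μ0 ν0 h1 h2 h3 h4 h5 h6 n, ?_⟩
  intro μ0 πhat h1 h2 h3 h4 h5 h6 hinv n
  have hπ : ∀ m, tcpChainLaw H R Rinv πhat m = πhat := by
    intro m
    induction m with
    | zero => rfl
    | succ m ih => simp only [tcpChainLaw]; rw [ih, hinv]
  have := tcp_aux r hrpos hrinc R Rinv hR hRmap hRinvmap hRinv
    hRinv' H hHprob hHsupp p hp μ0 πhat h1 h2 h3 h4 h5 h6 n
  rwa [hπ n] at this
end
end

section
/- Consider the TCP window size process generated by Lf(x) = f'(x) + r(x)(∫₀¹ f(hx) H(dh) − f(x)) with H = δ_{1/2} and r non-increasing with inf_{x≥0}(r(x) − x r'(x)) > 0 (so the Wasserstein curvature is positive and an invariant probability measure π exists). Its carré du champ operator is Γf(x) = r(x)(f(x/2) − f(x))², and there exists a bounded measurable non-constant function f (e.g. any non-constant f satisfying f(x/2) = f(x) for all x > 0) with Var_π(f) > 0 and Γf ≡ 0. Consequently π does not satisfy a Poincaré inequality: there is no λ > 0 such that λ Var_π(f) ≤ ∫ Γf dπ holds for all f in the domain. -/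
open MeasureTheory ProbabilityTheory Filter Set

noncomputable section

/-- The TCP generator with deterministic halving jumps (`𝓗 = δ_{1/2}`):
`L f(x) = f'(x) + r(x) (f(x/2) - f(x))`. -/
def tcpHalfGen (r : ℝ → ℝ) (f : ℝ → ℝ) (x : ℝ) : ℝ :=
  deriv f x + r x * (f (x / 2) - f x)

/-- The carré du champ operator `Γ f = ½ L(f²) - f L f = r(x)(f(x/2) - f(x))²`. -/
def tcpCarre (r : ℝ → ℝ) (f : ℝ → ℝ) (x : ℝ) : ℝ :=
  r x * (f (x / 2) - f x) ^ 2

/-- Variance of `f` with respect to `π`. -/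
def VarPi (π : Measure ℝ) (f : ℝ → ℝ) : ℝ :=
  ∫ x, (f x - ∫ y, f y ∂π) ^ 2 ∂π

/-- From an atom of the invariant law, the process stays in every full-measure set. -/
lemma ker_null (M : MarkovSemigroup) (π : Measure ℝ)
    (hinv : ∀ t : ℝ, 0 ≤ t → M.actM t π = π) (N : Set ℝ) (hN : MeasurableSet N)
    (hπN : π N = 0) (x : ℝ) (hx : π {x} ≠ 0) (t : ℝ) (ht : 0 ≤ t) : M.ker t x N = 0 := by
  have h1 := hinv t ht
  unfold MarkovSemigroup.actM at h1
  have h2 : ∫⁻ y, M.ker t y N ∂π = 0 := by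
    rw [← Measure.bind_apply hN (M.ker t).aemeasurable, h1, hπN]
  rw [lintegral_eq_zero_iff ((M.ker t).measurable_coe hN)] at h2
  by_contra hne
  apply hx
  refine measure_mono_null ?_ (ae_iff.1 h2)
  rintro y rfl
  simpa using hne

lemma actF_abs_le (M : MarkovSemigroup) (s : ℝ) (f : ℝ → ℝ) (C : ℝ) (x : ℝ)
    (h : ∀ᵐ y ∂(M.ker s x), |f y| ≤ C) : |M.actF s f x| ≤ C := by
  have := M.markov s
  have h1 := norm_integral_le_of_norm_le_const (μ := M.ker s x) (f := f) (C := C) h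
  simpa [MarkovSemigroup.actF] using h1

lemma no_isolated_atom (r : ℝ → ℝ) (hr : ContDiff ℝ (⊤ : ℕ∞) r) (M : MarkovSemigroup)
    (hgen : ∀ f : ℝ → ℝ, ContDiff ℝ (⊤ : ℕ∞) f → ∀ x : ℝ, 0 ≤ x → ∀ t : ℝ, 0 ≤ t →
      M.actF t f x = f x + ∫ s in (0:ℝ)..t, M.actF s (tcpHalfGen r f) x)
    (π : Measure ℝ)
    (hinv : ∀ t : ℝ, 0 ≤ t → M.actM t π = π)
    (O : Set ℝ) (hO : MeasurableSet O) (hOπ : π Oᶜ = 0) (hO0 : ∀ y ∈ O, 0 ≤ y)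
    (hOh : ∀ y ∈ O, y / 2 ∈ O) (x : ℝ) (hxO : x ∈ O) (hx : π {x} ≠ 0)
    (ε : ℝ) (hε : 0 < ε) (hiso : ∀ y ∈ O, |y - x| < ε → y = x) : False := by
  have hker : ∀ s, 0 ≤ s → ∀ᵐ y ∂(M.ker s x), y ∈ O := fun s hs =>
    ker_null M π hinv Oᶜ hO.compl hOπ x hx s hs
  have hx0 := hO0 x hxO
  let χ : ContDiffBump x := ⟨ε / 2, ε, by linarith, by linarith⟩
  have hχd : ContDiff ℝ (⊤ : ℕ∞) (χ : ℝ → ℝ) := χ.contDiff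
  have hχc : HasCompactSupport (χ : ℝ → ℝ) := χ.hasCompactSupport
  have hχx : χ x = 1 := χ.one_of_mem_closedBall (by simp [χ]; linarith)
  have hχO : ∀ y ∈ O, y ≠ x → χ y = 0 := by
    intro y hy hne
    apply χ.zero_of_le_dist
    by_contra hlt
    push Not at hlt
    rw [Real.dist_eq] at hlt
    exact hne (hiso y hy hlt)
  have hχdiff : Differentiable ℝ (χ : ℝ → ℝ) := hχd.differentiable (by simp)
  -- bound on the generator of the bump
  obtain ⟨C, hC⟩ : ∃ C, ∀ y, |tcpHalfGen r χ y| ≤ C := by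
    have hcont : Continuous (tcpHalfGen r χ) := by
      unfold tcpHalfGen
      have h1 : Continuous (deriv (χ : ℝ → ℝ)) := hχd.continuous_deriv (by simp)
      have h2 := hr.continuous
      have h3 := hχd.continuous
      fun_prop
    have hcs : HasCompactSupport (tcpHalfGen r χ) := by
      have h2 : HasCompactSupport (fun y : ℝ => χ (y / 2)) := by
        have := hχc.comp_homeomorph (Homeomorph.mulRight₀ (1/2 : ℝ) (by norm_num))
        convert this using 2
        simp [div_eq_mul_inv, Function.comp]
      exact hχc.deriv.add ((h2.sub hχc).mul_left)
    obtain ⟨C, hC⟩ := hcs.exists_bound_of_continuous hcont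
    exact ⟨C, hC⟩
  have hC0 : 0 ≤ C := (abs_nonneg _).trans (hC 0)
  have hstep : ∀ y, 0 ≤ y → ∀ t, 0 ≤ t → |M.actF t χ y - χ y| ≤ C * t := by
    intro y hy t ht
    rw [hgen χ hχd y hy t ht, add_sub_cancel_left]
    have := intervalIntegral.norm_integral_le_of_norm_le_const
      (f := fun s => M.actF s (tcpHalfGen r χ) y) (a := 0) (b := t) (C := C)
      (fun s _ => actF_abs_le M s _ C y (Eventually.of_forall hC))
    simpa [abs_of_nonneg ht] using this
  have hint : ∀ s z, Integrable (χ : ℝ → ℝ) (M.ker s z) := by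
    intro s z
    have := M.markov s
    exact hχd.continuous.integrable_of_hasCompactSupport hχc
  have hlip : ∀ s t, 0 ≤ s → 0 ≤ t → |M.actF (t + s) χ x - M.actF s χ x| ≤ C * t := by
    intro s t hs ht
    have hms := M.markov s
    have hmt := M.markov t
    have h1 : M.actF (t + s) χ x = ∫ y, M.actF t χ y ∂(M.ker s x) := by
      unfold MarkovSemigroup.actF
      rw [M.ker_add t s ht hs, Kernel.integral_comp]
      rw [← M.ker_add t s ht hs]
      exact hint _ _
    have hi : Integrable (fun y => M.actF t χ y) (M.ker s x) := by
      have h2 := hint (t + s) x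
      rw [M.ker_add t s ht hs] at h2
      exact h2.integral_comp
    have h3 : M.actF (t + s) χ x - M.actF s χ x
        = M.actF s (fun y => M.actF t χ y - χ y) x := by
      rw [h1]
      exact (integral_sub hi (hint s x)).symm
    rw [h3]
    apply actF_abs_le
    filter_upwards [hker s hs] with y hy
    exact hstep y (hO0 y hy) t ht
  have hcont : ContinuousOn (fun s => M.actF s χ x) (Set.Ici 0) := by
    have : LipschitzOnWith (Real.toNNReal C) (fun s => M.actF s χ x) (Set.Ici 0) := by
      apply LipschitzOnWith.of_dist_le_mul
      have key : ∀ a b : ℝ, 0 ≤ a → a ≤ b →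
          dist (M.actF a χ x) (M.actF b χ x) ≤ C * dist a b := by
        intro a b ha hab
        have := hlip a (b - a) ha (by linarith)
        rw [dist_comm, dist_comm a b, Real.dist_eq, Real.dist_eq,
          abs_of_nonneg (sub_nonneg.2 hab)]
        simpa using this
      intro a ha b hb
      rw [Real.coe_toNNReal C hC0]
      rcases le_total a b with h | h
      · exact key a b ha h
      · rw [dist_comm, dist_comm a b]
        exact key b a hb h
    exact this.continuousOn
  -- the test function
  have hgd : ContDiff ℝ (⊤ : ℕ∞) (fun y => (y - x) * χ y) :=
    (contDiff_id.sub contDiff_const).mul hχd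
  have hgO : ∀ y ∈ O, (y - x) * χ y = 0 := by
    intro y hy
    by_cases h : y = x
    · simp [h]
    · rw [hχO y hy h, mul_zero]
  have hLg : ∀ y ∈ O, tcpHalfGen r (fun y => (y - x) * χ y) y = χ y := by
    intro y hy
    unfold tcpHalfGen
    simp only []
    rw [hgO y hy, hgO _ (hOh y hy)]
    have hd : HasDerivAt (fun y => (y - x) * χ y) (1 * χ y + (y - x) * deriv χ y) y :=
      ((hasDerivAt_id y).sub_const x).mul (hχdiff y).hasDerivAt
    rw [hd.deriv]
    by_cases h : y = x
    · simp [h]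
    · have hmin : IsLocalMin (χ : ℝ → ℝ) y := by
        refine Eventually.of_forall fun z => ?_
        rw [hχO y hy h]
        exact χ.nonneg
      rw [hmin.deriv_eq_zero]
      simp
  have hzero : ∀ t, 0 ≤ t → ∫ s in (0:ℝ)..t, M.actF s χ x = 0 := by
    intro t ht
    have h1 := hgen _ hgd x hx0 t ht
    have h2 : M.actF t (fun y => (y - x) * χ y) x = 0 := by
      unfold MarkovSemigroup.actF
      apply integral_eq_zero_of_ae
      filter_upwards [hker t ht] with y hy
      exact hgO y hy
    have h3 : ∫ s in (0:ℝ)..t, M.actF s (tcpHalfGen r (fun y => (y - x) * χ y)) x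
        = ∫ s in (0:ℝ)..t, M.actF s χ x := by
      apply intervalIntegral.integral_congr
      intro s hs
      rw [uIcc_of_le ht] at hs
      unfold MarkovSemigroup.actF
      apply integral_congr_ae
      filter_upwards [hker s hs.1] with y hy
      exact hLg y hy
    rw [h2, h3] at h1
    simp at h1
    exact h1.symm
  have ht0 : 0 < 1 / (C + 1) := by positivity
  have hpos : 0 < ∫ s in (0:ℝ)..(1 / (C + 1)), M.actF s χ x := by
    apply intervalIntegral.intervalIntegral_pos_of_pos_on _ _ ht0
    · apply ContinuousOn.intervalIntegrable
      rw [uIcc_of_le ht0.le]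
      exact hcont.mono Icc_subset_Ici_self
    · intro s hs
      have h1 := hstep x hx0 s hs.1.le
      rw [hχx] at h1
      have h2 : s * (C + 1) < 1 := (lt_div_iff₀ (by positivity)).1 hs.2
      have h3 := (abs_le.1 h1).1
      nlinarith [hs.1]
  exact hpos.ne' (hzero _ ht0.le)

/-- A halving-invariant bounded function: the fractional part of `log₂ y` for `y > 0`. -/
def invFn (y : ℝ) : ℝ := if y = 0 then 2 else Int.fract (Real.logb 2 y)

lemma invFn_half (y : ℝ) : invFn (y / 2) = invFn y := by
  unfold invFn
  by_cases h : y = 0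
  · simp [h]
  · have : Real.logb 2 (y / 2) = Real.logb 2 y - 1 := by
      rw [Real.logb_div h (by norm_num), Real.logb_self_eq_one (by norm_num)]
    simp [h, this]

lemma invFn_meas : Measurable invFn := by
  unfold invFn
  refine Measurable.ite (measurableSet_singleton 0) measurable_const ?_
  exact Measurable.fract (Real.measurable_log.div_const _)

lemma invFn_bdd (y : ℝ) : |invFn y| ≤ 2 := by
  unfold invFn
  split_ifs
  · norm_num
  · rw [abs_of_nonneg (Int.fract_nonneg _)]
    linarith [Int.fract_lt_one (Real.logb 2 y)]

lemma invFn_zero_iff {y z : ℝ} (h : invFn y = invFn z) (hz : z = 0) : y = 0 := by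
  by_contra hy
  simp only [invFn, hz, hy, if_true, if_false] at h
  linarith [Int.fract_lt_one (Real.logb 2 y)]

lemma invFn_eq {y z : ℝ} (h : invFn y = invFn z) (hy : 0 < y) (hz : 0 < z) :
    ∃ n : ℤ, y = z * (2:ℝ) ^ n := by
  simp only [invFn, hy.ne', hz.ne', if_false] at h
  obtain ⟨n, hn⟩ := Int.fract_eq_fract.1 h
  refine ⟨n, ?_⟩
  have h1 : Real.logb 2 y = Real.logb 2 z + n := by linarith
  rw [← Real.rpow_logb (b := 2) (by norm_num) (by norm_num) hy, h1,
    Real.rpow_add (by norm_num), Real.rpow_logb (by norm_num) (by norm_num) hz,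
    Real.rpow_intCast]

lemma invFn_iso {y z : ℝ} (h : invFn y = invFn z) (hy : 0 < y) (hz : 0 < z)
    (hd : |y - z| < z / 2) : y = z := by
  obtain ⟨n, rfl⟩ := invFn_eq h hy hz
  rw [abs_lt] at hd
  have h1 : (2:ℝ) ^ n < 2 ^ (1:ℤ) := by
    rw [zpow_one]; by_contra hc; push Not at hc; nlinarith
  have h2 : (2:ℝ) ^ (-1:ℤ) < 2 ^ n := by
    rw [zpow_neg_one]; by_contra hc; push Not at hc; nlinarith
  rw [zpow_lt_zpow_iff_right₀ (by norm_num)] at h1 h2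
  have : n = 0 := by omega
  simp [this]

lemma varPi_pos (r : ℝ → ℝ) (hr : ContDiff ℝ (⊤ : ℕ∞) r) (M : MarkovSemigroup)
    (hgen : ∀ f : ℝ → ℝ, ContDiff ℝ (⊤ : ℕ∞) f → ∀ x : ℝ, 0 ≤ x → ∀ t : ℝ, 0 ≤ t →
      M.actF t f x = f x + ∫ s in (0:ℝ)..t, M.actF s (tcpHalfGen r f) x)
    (π : Measure ℝ) (hπ : IsProbabilityMeasure π) (hπsupp : SuppIn (Set.Ici 0) π)
    (hinv : ∀ t : ℝ, 0 ≤ t → M.actM t π = π) : 0 < VarPi π invFn := by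
  have hnn : 0 ≤ VarPi π invFn := integral_nonneg fun _ => sq_nonneg _
  refine lt_of_le_of_ne hnn fun h0 => ?_
  unfold VarPi at h0
  set c := ∫ y, invFn y ∂π with hc
  have hcb : |c| ≤ 2 := by
    have := norm_integral_le_of_norm_le_const (μ := π) (f := invFn) (C := 2)
      (Eventually.of_forall invFn_bdd)
    simpa using this
  have hint : Integrable (fun x => (invFn x - c) ^ 2) π := by
    refine Integrable.of_bound ((invFn_meas.sub_const c).pow_const 2).aestronglyMeasurable 16
      (Eventually.of_forall fun x => ?_)
    rw [Real.norm_eq_abs, abs_of_nonneg (sq_nonneg _)]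
    have h1 := abs_le.1 (invFn_bdd x)
    have h2 := abs_le.1 hcb
    nlinarith
  rw [eq_comm, integral_eq_zero_iff_of_nonneg (fun _ => sq_nonneg _) hint] at h0
  let O : Set ℝ := {y | 0 ≤ y ∧ invFn y = c}
  have hO : MeasurableSet O :=
    measurableSet_Ici.inter (invFn_meas (measurableSet_singleton c))
  have hOπ : π Oᶜ = 0 := by
    have h2 : ∀ᵐ y ∂π, y ∈ Set.Ici (0:ℝ) := hπsupp
    have h3 : ∀ᵐ y ∂π, y ∈ O := by
      filter_upwards [h0, h2] with y hy hy2
      exact ⟨hy2, by simpa [sub_eq_zero] using hy⟩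
    exact h3
  have hpos : ∀ y ∈ O, ∀ z ∈ O, z ≠ 0 → 0 < y := by
    intro y hy z hz hne
    refine lt_of_le_of_ne hy.1 fun h => hne ?_
    exact invFn_zero_iff (hz.2.trans hy.2.symm) h.symm
  obtain ⟨z, hz⟩ : O.Nonempty := by
    rw [nonempty_iff_ne_empty]
    intro h
    rw [h] at hOπ
    simp at hOπ
  have hcount : O.Countable := by
    refine (countable_range (fun n : ℤ => z * (2:ℝ) ^ n)).mono fun y hy => ?_
    by_cases h : z = 0
    · have : y = 0 := invFn_zero_iff (hy.2.trans hz.2.symm) h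
      exact ⟨0, by simp [h, this]⟩
    · obtain ⟨n, hn⟩ := invFn_eq (hy.2.trans hz.2.symm) (hpos y hy z hz h) (hpos z hz z hz h)
      exact ⟨n, hn.symm⟩
  obtain ⟨x, hxO, hx⟩ : ∃ x ∈ O, π {x} ≠ 0 := by
    by_contra hcon
    push Not at hcon
    have h1 : π O = 0 := by
      rw [← biUnion_of_singleton O]
      exact (measure_biUnion_null_iff hcount).2 hcon
    have h2 : π Set.univ = 0 := by
      rw [← union_compl_self O]
      exact measure_union_null h1 hOπ
    simp at h2
  have hOh : ∀ y ∈ O, y / 2 ∈ O := fun y hy =>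
    ⟨by linarith [hy.1], (invFn_half y).trans hy.2⟩
  by_cases h : x = 0
  · exact no_isolated_atom r hr M hgen π hinv O hO hOπ (fun y hy => hy.1) hOh x hxO hx 1
      one_pos fun y hy _ => (invFn_zero_iff (hy.2.trans hxO.2.symm) h).trans h.symm
  · have hxp := hpos x hxO x hxO h
    exact no_isolated_atom r hr M hgen π hinv O hO hOπ (fun y hy => hy.1) hOh x hxO hx (x / 2)
      (by linarith) fun y hy hd =>
        invFn_iso (hy.2.trans hxO.2.symm) (hpos y hy x hxO h) hxp hd

/-- The invariant law of the TCP process does not satisfy a Poincaré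
inequality. For the TCP window size process with `𝓗 = δ_{1/2}` and `r` non-increasing
with `inf_{x≥0}(r(x) - x r'(x)) > 0`, the carré du champ is
`Γf(x) = r(x)(f(x/2) - f(x))²`; there is a bounded measurable non-constant `f`
(any non-constant `f` with `f(x/2) = f(x)`) with `Var_π(f) > 0` and `Γf ≡ 0`.
Consequently there is no `λ > 0` with `λ Var_π(f) ≤ ∫ Γf dπ` for all `f`. -/
theorem stmt18_tcp_no_poincare
    (r : ℝ → ℝ) (hr : ContDiff ℝ (⊤ : ℕ∞) r) (hrpos : ∀ x : ℝ, 0 ≤ x → 0 ≤ r x)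
    (hrdec : AntitoneOn r (Set.Ici 0))
    -- positive Wasserstein curvature: `inf_{x ≥ 0} (r(x) - x r'(x)) > 0`
    (hcurv : 0 < ⨅ x : Set.Ici (0:ℝ), (r x - (x : ℝ) * deriv r x))
    (M : MarkovSemigroup)
    -- `M` is the semigroup of the TCP process with halving jumps (Itô–Dynkin formula)
    (hgen : ∀ f : ℝ → ℝ, ContDiff ℝ (⊤ : ℕ∞) f → ∀ x : ℝ, 0 ≤ x → ∀ t : ℝ, 0 ≤ t →
      M.actF t f x = f x + ∫ s in (0:ℝ)..t, M.actF s (tcpHalfGen r f) x)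
    -- `π` is the invariant probability measure of the process
    (π : Measure ℝ) (hπ : IsProbabilityMeasure π) (hπsupp : SuppIn (Set.Ici 0) π)
    (hπmom : FinMom π)
    (hinv : ∀ t : ℝ, 0 ≤ t → M.actM t π = π) :
    (∃ f : ℝ → ℝ, Measurable f ∧ (∃ C, ∀ x, |f x| ≤ C) ∧
      0 < VarPi π f ∧ ∀ x : ℝ, 0 ≤ x → tcpCarre r f x = 0) ∧
    ¬ ∃ lam : ℝ, 0 < lam ∧
        ∀ f : ℝ → ℝ, Measurable f → (∃ C, ∀ x, |f x| ≤ C) →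
          lam * VarPi π f ≤ ∫ x, tcpCarre r f x ∂π := by
  have hv := varPi_pos r hr M hgen π hπ hπsupp hinv
  have hΓ : ∀ x, tcpCarre r invFn x = 0 := fun x => by simp [tcpCarre, invFn_half]
  refine ⟨⟨invFn, invFn_meas, ⟨2, invFn_bdd⟩, hv, fun x _ => hΓ x⟩, ?_⟩
  rintro ⟨lam, hlam, h⟩
  have h1 := h invFn invFn_meas ⟨2, invFn_bdd⟩
  simp only [hΓ, integral_zero] at h1
  exact absurd h1 (not_le.2 (mul_pos hlam hv))
end
end
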